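/- arXiv:2502.18259 — 7 statements merged into one kernel-verified Lean document; each statement's English description precedes it below -/
import Mathlib

section
/- Let L be a first-order language and T a theory over L. Suppose that for every pair of terms t₁, t₂ : Term L ℕ the e-generalization problem {t₁, t₂} has a least general solution. Then for every m ≥ 1 and every family of terms t : Fin m → Term L ℕ, the e-generalization problem {t 0, …, t (m-1)} has a least general solution. (In other words, if a variety has unitary e-generalization 2-type, then it has unitary e-generalization type.) -/
open FirstOrder FirstOrder.Language

/-- Two terms are `T`-equivalent if they realize to the same element in every model of `T`
under every variable assignment. -/
def TEquiv (L : Language) (T : L.Theory) (p q : L.Term ℕ) : Prop :=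
  ∀ (M : Type*) [L.Structure M], M ⊨ T → ∀ v : ℕ → M, p.realize v = q.realize v

/-- `s` is a solution (generalizer) of the e-generalization problem `t 0, …, t (m-1)`:
there are substitutions `σ k` with `s.subst (σ k)` `T`-equivalent to `t k` for each `k`. -/
def IsSolution (L : Language) (T : L.Theory) {m : ℕ} (t : Fin m → L.Term ℕ)
    (s : L.Term ℕ) : Prop :=
  ∃ σ : Fin m → (ℕ → L.Term ℕ), ∀ k, TEquiv L T (s.subst (σ k)) (t k)

/-- `s ⪯ u`: `s` is less general than `u`, i.e. some substitution sends `u` to a term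
`T`-equivalent to `s`. -/
def LessGeneral (L : Language) (T : L.Theory) (s u : L.Term ℕ) : Prop :=
  ∃ τ : ℕ → L.Term ℕ, TEquiv L T (u.subst τ) s

section

variable {L : Language} {T : L.Theory}

theorem TEquiv.trans {p q r : L.Term ℕ} (hpq : TEquiv L T p q) (hqr : TEquiv L T q r) :
    TEquiv L T p r :=
  fun M _ hM v => (hpq M hM v).trans (hqr M hM v)

theorem TEquiv.subst {p q : L.Term ℕ} (h : TEquiv L T p q) (τ : ℕ → L.Term ℕ) :
    TEquiv L T (p.subst τ) (q.subst τ) := fun M _ hM v => by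
  simpa only [Term.realize_subst] using h M hM fun n => (τ n).realize v

theorem TEquiv.subst_comp {p q r : L.Term ℕ} {σ τ : ℕ → L.Term ℕ}
    (hpq : TEquiv L T (p.subst σ) q) (hqr : TEquiv L T (q.subst τ) r) :
    TEquiv L T (p.subst fun n => (σ n).subst τ) r := fun M _ hM v => by
  have h := (hpq.subst τ).trans hqr M hM v
  simpa only [Term.realize_subst] using h

theorem TEquiv.subst_var (p : L.Term ℕ) : TEquiv L T (p.subst Term.var) p := fun M _ _ v => by
  simp only [Term.realize_subst, Term.realize_var]

/-- A term solves an e-generalization problem iff it is more general than each of its terms. -/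
theorem isSolution_iff_forall_lessGeneral {m : ℕ} {t : Fin m → L.Term ℕ} {s : L.Term ℕ} :
    IsSolution L T t s ↔ ∀ k, LessGeneral L T (t k) s :=
  ⟨fun ⟨σ, hσ⟩ k => ⟨σ k, hσ k⟩, fun h => ⟨fun k => (h k).choose, fun k => (h k).choose_spec⟩⟩

theorem LessGeneral.refl (s : L.Term ℕ) : LessGeneral L T s s :=
  ⟨Term.var, TEquiv.subst_var s⟩

theorem LessGeneral.trans {s u w : L.Term ℕ} (hsu : LessGeneral L T s u)
    (huw : LessGeneral L T u w) : LessGeneral L T s w := by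
  obtain ⟨σ, hσ⟩ := hsu
  obtain ⟨τ, hτ⟩ := huw
  exact ⟨_, hτ.subst_comp hσ⟩

end

/-- If every two-term e-generalization problem has a least general solution, then every
e-generalization problem (of any finite size `m ≥ 1`) has a least general solution. -/
theorem unitary_two_type_implies_unitary_type (L : Language) (T : L.Theory)
    (h2 : ∀ t₁ t₂ : L.Term ℕ, ∃ s, IsSolution L T ![t₁, t₂] s ∧
      ∀ s', IsSolution L T ![t₁, t₂] s' → LessGeneral L T s s') :
    ∀ (m : ℕ), 1 ≤ m → ∀ t : Fin m → L.Term ℕ, ∃ s, IsSolution L T t s ∧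
      ∀ s', IsSolution L T t s' → LessGeneral L T s s' := by
  simp only [isSolution_iff_forall_lessGeneral, Fin.forall_fin_two, Matrix.cons_val_zero,
    Matrix.cons_val_one] at h2 ⊢
  intro m hm
  induction m, hm using Nat.le_induction with
  | base =>
    exact fun t => ⟨t 0, fun k => Subsingleton.elim 0 k ▸ LessGeneral.refl _, fun _ h => h 0⟩
  | succ m _ ih =>
    intro t
    obtain ⟨s, hs, hs_least⟩ := ih fun k => t k.castSucc
    obtain ⟨r, ⟨hsr, htr⟩, hr_least⟩ := h2 s (t (Fin.last m))
    exact ⟨r, Fin.lastCases htr fun k => (hs k).trans hsr, fun s' h =>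
      hr_least s' ⟨hs_least s' fun k => h k.castSucc, h (Fin.last m)⟩⟩
end

section
/- Commutative monoids have unitary e-generalization type: for every type X, every m ≥ 1, and every family t : Fin m → (X →₀ ℕ) of elements of the free commutative monoid on X, there exist n : ℕ, an element s : Fin n →₀ ℕ, and additive monoid homomorphisms σₖ : (Fin n →₀ ℕ) →+ (X →₀ ℕ) with σₖ s = t k for every k : Fin m, such that for every n' : ℕ, every s' : Fin n' →₀ ℕ, and every family of additive monoid homomorphisms σ'ₖ : (Fin n' →₀ ℕ) →+ (X →₀ ℕ) with σ'ₖ s' = t k for every k, there exists an additive monoid homomorphism τ : (Fin n' →₀ ℕ) →+ (Fin n →₀ ℕ) with τ s' = s. -/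
/-- Commutative monoids have unitary e-generalization type: every e-generalization problem
`t : Fin m → (X →₀ ℕ)` in the free commutative monoid `X →₀ ℕ` has a solution
`s : Fin n →₀ ℕ` that is less general than every other solution. -/
theorem commMonoid_unitary_type (X : Type*) (m : ℕ) (hm : 1 ≤ m)
    (t : Fin m → (X →₀ ℕ)) :
    ∃ (n : ℕ) (s : Fin n →₀ ℕ) (σ : Fin m → ((Fin n →₀ ℕ) →+ (X →₀ ℕ))),
      (∀ k, σ k s = t k) ∧
      ∀ (n' : ℕ) (s' : Fin n' →₀ ℕ) (σ' : Fin m → ((Fin n' →₀ ℕ) →+ (X →₀ ℕ))),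
        (∀ k, σ' k s' = t k) →
        ∃ τ : (Fin n' →₀ ℕ) →+ (Fin n →₀ ℕ), τ s' = s := by
  let e := Fintype.equivFin (Σ k : Fin m, (t k).support)
  let s : Fin _ →₀ ℕ :=
    Finsupp.equivFunOnFinite.symm fun i => t (e.symm i).1 ((e.symm i).2 : X)
  refine ⟨_, s, fun k => ∑ x : (t k).support,
    (Finsupp.singleAddHom (x : X)).comp (Finsupp.applyAddHom (e ⟨k, x⟩)), ?_, ?_⟩
  · intro k
    have hs : ∀ x : (t k).support, s (e ⟨k, x⟩) = t k x := fun x => by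
      change t (e.symm (e ⟨k, x⟩)).1 ((e.symm (e ⟨k, x⟩)).2 : X) = t k x
      rw [e.symm_apply_apply]
    simp only [AddMonoidHom.finsetSum_apply, AddMonoidHom.comp_apply,
      Finsupp.applyAddHom_apply, Finsupp.singleAddHom_apply, hs]
    rw [Finset.sum_coe_sort (t k).support fun x => Finsupp.single x (t k x)]
    exact Finsupp.sum_single (t k)
  · intro n' s' σ' h
    refine ⟨∑ i, (Finsupp.singleAddHom i).comp
      ((Finsupp.applyAddHom ((e.symm i).2 : X)).comp (σ' (e.symm i).1)), ?_⟩
    simp only [AddMonoidHom.finsetSum_apply, AddMonoidHom.comp_apply,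
      Finsupp.applyAddHom_apply, Finsupp.singleAddHom_apply, h]
    exact Finsupp.univ_sum_single s
end

section
/- Abelian groups have unitary e-generalization type: for every type X, every m ≥ 1, and every family t : Fin m → (X →₀ ℤ) of elements of the free abelian group on X, there exist n : ℕ, an element s : Fin n →₀ ℤ, and additive group homomorphisms σₖ : (Fin n →₀ ℤ) →+ (X →₀ ℤ) with σₖ s = t k for every k : Fin m, such that for every n' : ℕ, every s' : Fin n' →₀ ℤ, and every family of additive group homomorphisms σ'ₖ : (Fin n' →₀ ℤ) →+ (X →₀ ℤ) with σ'ₖ s' = t k for every k, there exists an additive group homomorphism τ : (Fin n' →₀ ℤ) →+ (Fin n →₀ ℤ) with τ s' = s. -/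
/-- An integer-valued additive map on a free abelian group takes, at any element, a value in the
ideal generated by the coordinates of that element. -/
theorem Finsupp.addMonoidHom_apply_mem_span_range {ι : Type*} (f : (ι →₀ ℤ) →+ ℤ) (s : ι →₀ ℤ) :
    f s ∈ Ideal.span (Set.range s) := by
  have h_sum : f s = s.sum fun i a => a * f (Finsupp.single i 1) := by
    conv_lhs => rw [← Finsupp.sum_single s]
    rw [map_finsuppSum]
    refine Finsupp.sum_congr fun i _ => ?_
    rw [← smul_eq_mul, ← map_zsmul, Finsupp.smul_single, smul_eq_mul, mul_one]
  rw [h_sum]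
  exact Ideal.sum_mem _ fun i _ =>
    Ideal.mul_mem_right _ _ (Ideal.subset_span (Set.mem_range_self i))

/-- Abelian groups have unitary e-generalization type: every e-generalization problem
`t : Fin m → (X →₀ ℤ)` in the free abelian group `X →₀ ℤ` has a solution
`s : Fin n →₀ ℤ` that is less general than every other solution. -/
theorem abelianGroup_unitary_type (X : Type*) (m : ℕ) (hm : 1 ≤ m)
    (t : Fin m → (X →₀ ℤ)) :
    ∃ (n : ℕ) (s : Fin n →₀ ℤ) (σ : Fin m → ((Fin n →₀ ℤ) →+ (X →₀ ℤ))),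
      (∀ k, σ k s = t k) ∧
      ∀ (n' : ℕ) (s' : Fin n' →₀ ℤ) (σ' : Fin m → ((Fin n' →₀ ℤ) →+ (X →₀ ℤ))),
        (∀ k, σ' k s' = t k) →
        ∃ τ : (Fin n' →₀ ℤ) →+ (Fin n →₀ ℤ), τ s' = s := by
  obtain ⟨d, hd⟩ := IsPrincipalIdealRing.principal
    (Ideal.span (Set.range fun p : Fin m × X => t p.1 p.2))
  have h_dvd : ∀ k x, d ∣ t k x := fun k x => by
    rw [← Ideal.mem_span_singleton, ← Ideal.submodule_span_eq, ← hd]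
    exact Ideal.subset_span ⟨(k, x), rfl⟩
  refine ⟨1, Finsupp.single 0 d, fun k =>
    ((zmultiplesHom (X →₀ ℤ)) ((t k).mapRange (· / d) (Int.zero_ediv d))).comp
      (Finsupp.applyAddHom 0), fun k => ?_, fun n' s' σ' h => ?_⟩
  · ext x
    simpa using Int.mul_ediv_cancel' (h_dvd k x)
  · have h_mem : d ∈ Ideal.span (Set.range s') := by
      have h_le : Ideal.span (Set.range fun p : Fin m × X => t p.1 p.2) ≤
          Ideal.span (Set.range s') := by
        rw [Ideal.span_le]
        rintro _ ⟨⟨k, x⟩, rfl⟩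
        simpa [h k] using Finsupp.addMonoidHom_apply_mem_span_range
          ((Finsupp.applyAddHom x).comp (σ' k)) s'
      exact h_le (hd ▸ Submodule.mem_span_singleton_self d)
    obtain ⟨c, hc⟩ := Ideal.mem_span_range_iff_exists_fun.1 h_mem
    refine ⟨(Finsupp.singleAddHom 0).comp
      (∑ i, (AddMonoidHom.mulLeft (c i)).comp (Finsupp.applyAddHom i)), ?_⟩
    simp [AddMonoidHom.finsetSum_apply, hc]
end

section
/- Let N₃ be the quotient of the additive monoid ℕ by the additive congruence generated by the single pair (3, 4) (so N₃ is the monoid {0,1,2,3} with addition truncated at 3), let [k] denote the class of k in N₃, and let S be the additive submonoid of N₃ generated by [2] (so S has underlying set {[0],[2],[3]}). Then for every additive monoid homomorphism j : N₃ →+ S with j [1] equal to the element [2] of S, and every additive monoid homomorphism i : S →+ N₃, the composite j ∘ i is not the identity homomorphism of S. In particular, S is a 1-generated subalgebra of an algebra of the variety generated by N₃ that is not a retract along the surjection j, so S is not projective in that variety. -/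
/-- The additive congruence on `ℕ` generated by the single pair `(3, 4)`. -/
def truncCon : AddCon ℕ := addConGen (fun a b => a = 3 ∧ b = 4)

/-- `N₃`: the monoid `{0,1,2,3}` with addition truncated at `3`, as the quotient of `ℕ`
by the additive congruence generated by `(3,4)`. -/
abbrev N3 : Type := truncCon.Quotient

/-- The additive submonoid of `N₃` generated by the class of `2`;
its underlying set is `{[0],[2],[3]}`. -/
def S : AddSubmonoid N3 := AddSubmonoid.closure {((2 : ℕ) : N3)}

/-- Classes in `N₃` are separated by truncation at `3`. -/
theorem min_three_eq_of_coe_eq {a b : ℕ} (h : ((a : ℕ) : N3) = ((b : ℕ) : N3)) :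
    min a 3 = min b 3 := by
  let c : AddCon ℕ :=
    { r := fun x y => min x 3 = min y 3
      iseqv := ⟨fun _ => rfl, Eq.symm, Eq.trans⟩
      add' := by intro w x y z h₁ h₂; omega }
  have hle : truncCon ≤ c := by
    refine AddCon.addConGen_le.2 ?_
    rintro x y ⟨rfl, rfl⟩
    change min 3 3 = min 4 3
    decide
  exact hle ((AddCon.eq truncCon).1 h)

theorem coe_three_eq_coe_four : ((3 : ℕ) : N3) = ((4 : ℕ) : N3) :=
  (AddCon.eq truncCon).2 (AddConGen.Rel.of 3 4 ⟨rfl, rfl⟩)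

theorem coe_eq_nsmul_coe_one (n : ℕ) : ((n : ℕ) : N3) = n • ((1 : ℕ) : N3) := by
  have h := map_nsmul truncCon.mk' n 1
  rwa [smul_eq_mul, mul_one] at h

theorem coe_four_eq_coe_six : ((4 : ℕ) : N3) = ((6 : ℕ) : N3) := by
  have h₄ : ((4 : ℕ) : N3) = ((5 : ℕ) : N3) :=
    congrArg (· + ((1 : ℕ) : N3)) coe_three_eq_coe_four
  have h₅ : ((5 : ℕ) : N3) = ((6 : ℕ) : N3) :=
    congrArg (· + ((2 : ℕ) : N3)) coe_three_eq_coe_four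
  exact h₄.trans h₅

/-- `S` is not a retract of `N₃` along the surjection sending `[1]` to `[2]`: for any
additive monoid homomorphism `j : N₃ →+ S` with `j [1] = [2]` and any
`i : S →+ N₃`, the composite `j ∘ i` is not the identity of `S`. -/
theorem S_not_projective_retract :
    ∀ j : N3 →+ S, ((j ((1 : ℕ) : N3) : N3) = ((2 : ℕ) : N3)) →
      ∀ i : S →+ N3, j.comp i ≠ AddMonoidHom.id S := by
  intro j hj i hij
  set s : S := j ((1 : ℕ) : N3) with hs
  have hsmul (n : ℕ) : ((n • s : S) : N3) = ((n * 2 : ℕ) : N3) := by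
    rw [AddSubmonoidClass.coe_nsmul, hj]
    exact (map_nsmul truncCon.mk' n 2).symm
  obtain ⟨n, hn⟩ : ∃ n : ℕ, ((n : ℕ) : N3) = i s := Quotient.exists_rep (i s)
  have hjs : n • s = s := by
    rw [hs, ← map_nsmul, ← coe_eq_nsmul_coe_one, hn]
    exact DFunLike.congr_fun hij s
  have hn1 : n = 1 := by
    have h : ((n * 2 : ℕ) : N3) = ((2 : ℕ) : N3) := by rw [← hsmul, hjs, hj]
    have := min_three_eq_of_coe_eq h
    omega
  subst hn1
  have h23 : 2 • s = 3 • s := by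
    apply Subtype.ext
    rw [hsmul, hsmul]
    exact coe_four_eq_coe_six
  have h := congrArg i h23
  rw [map_nsmul, map_nsmul, ← hn, ← coe_eq_nsmul_coe_one, ← coe_eq_nsmul_coe_one] at h
  have := min_three_eq_of_coe_eq h
  omega
end

section
/- The direct product ℤ × ℤ of two copies of the 1-generated free group does not embed into any free group: for every type α, there is no injective group homomorphism from Multiplicative (ℤ × ℤ) to the free group FreeGroup α. Consequently, ℤ × ℤ is neither exact nor projective in the variety of groups. -/
/-- Distinct free generators do not commute, so a commutative free group has rank at most one. -/
theorem FreeGroup.subsingleton_of_mul_comm {β : Type*}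
    (h : ∀ x y : FreeGroup β, x * y = y * x) : Subsingleton β := by
  classical
  refine ⟨fun a b => by_contra fun hab => ?_⟩
  let g : β → Equiv.Perm (Fin 3) := fun c => if c = a then Equiv.swap 0 1 else Equiv.swap 1 2
  have hg : g a * g b = g b * g a := by
    simpa only [_root_.map_mul, FreeGroup.lift_apply_of] using
      congrArg (FreeGroup.lift g) (h (FreeGroup.of a) (FreeGroup.of b))
  simp only [g, if_pos, if_neg (Ne.symm hab)] at hg
  exact absurd hg (by decide)

theorem FreeGroup.isCyclic_of_subsingleton {β : Type*} [Subsingleton β] :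
    IsCyclic (FreeGroup β) := by
  cases isEmpty_or_nonempty β
  · infer_instance
  · have := Classical.inhabited_of_nonempty ‹Nonempty β›
    have := Unique.mk' β
    infer_instance

theorem IsFreeGroup.isCyclic_of_mul_comm {G : Type*} [Group G] [IsFreeGroup G]
    (h : ∀ x y : G, x * y = y * x) : IsCyclic G := by
  have e := IsFreeGroup.mulEquiv G
  have : Subsingleton (IsFreeGroup.Generators G) :=
    FreeGroup.subsingleton_of_mul_comm fun x y => e.injective (by simp [h (e x)])
  have := FreeGroup.isCyclic_of_subsingleton (β := IsFreeGroup.Generators G)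
  exact isCyclic_of_surjective e e.surjective

/-- `ℤ × ℤ` does not embed into any free group; hence it is neither exact nor projective
in the variety of groups. -/
theorem int_prod_int_not_embeddable_in_free_group (α : Type*) :
    ¬ ∃ f : Multiplicative (ℤ × ℤ) →* FreeGroup α, Function.Injective f := by
  rintro ⟨f, hf⟩
  have e := MonoidHom.ofInjective hf
  have : IsCyclic f.range :=
    IsFreeGroup.isCyclic_of_mul_comm fun x y => e.symm.injective (by simp [mul_comm])
  have : IsCyclic (Multiplicative (ℤ × ℤ)) := isCyclic_of_surjective e.symm e.symm.surjective
  exact not_isAddCyclic_prod_of_infinite_nontrivial ℤ ℤ (isCyclic_multiplicative_iff.mp this)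
end

section
/- The direct product ℕ × ℕ of two copies of the 1-generated free monoid does not embed into any free monoid: for every type α, there is no injective monoid homomorphism from Multiplicative (ℕ × ℕ) to the free monoid FreeMonoid α. Consequently, ℕ × ℕ is neither exact nor projective in the variety of monoids. -/
theorem FreeMonoid.eq_of_commute_of_length_eq {α : Type*} {u v : FreeMonoid α}
    (h : Commute u v) (hl : u.length = v.length) : u = v :=
  List.append_inj_left h.eq hl

theorem FreeMonoid.length_pow {α : Type*} (u : FreeMonoid α) (n : ℕ) :
    (u ^ n).length = n * u.length := by
  induction n with
  | zero => simp
  | succ n ih => rw [pow_succ, FreeMonoid.length_mul, ih, Nat.succ_mul]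

/-- Commuting elements of a free monoid have a common power. -/
theorem FreeMonoid.pow_length_eq_pow_length_of_commute {α : Type*} {u v : FreeMonoid α}
    (h : Commute u v) : u ^ v.length = v ^ u.length :=
  eq_of_commute_of_length_eq (h.pow_pow _ _) (by rw [length_pow, length_pow, mul_comm])

/-- `ℕ × ℕ` does not embed into any free monoid; hence it is neither exact nor projective
in the variety of monoids. -/
theorem nat_prod_nat_not_embeddable_in_free_monoid (α : Type*) :
    ¬ ∃ f : Multiplicative (ℕ × ℕ) →* FreeMonoid α, Function.Injective f := by
  rintro ⟨f, hf⟩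
  let a : Multiplicative (ℕ × ℕ) := Multiplicative.ofAdd (1, 0)
  let b : Multiplicative (ℕ × ℕ) := Multiplicative.ofAdd (0, 1)
  have hpow : a ^ (f b).length = b ^ (f a).length := hf <| by
    rw [map_pow, map_pow]
    exact FreeMonoid.pow_length_eq_pow_length_of_commute ((Commute.all a b).map f)
  have hlen : (f b).length = 0 := by
    simpa [a, b] using congrArg (fun x => (Multiplicative.toAdd x).1) hpow
  have hb : b = 1 := hf <| by rw [map_one, FreeMonoid.length_eq_zero.mp hlen]
  simpa [b] using congrArg (fun x => (Multiplicative.toAdd x).2) hb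
end

section
/- The three-element Gödel (Heyting) chain is not strongly projective among Heyting algebras: let G₃ and G₄ be Heyting algebras whose order is total (∀ a b, a ≤ b ∨ b ≤ a) and which have exactly 3 and exactly 4 elements respectively, let x : G₃ satisfy ⊥ < x and x < ⊤ (the middle element of the 3-chain), let b : G₄ be a coatom (IsCoatom b, the second-largest element of the 4-chain), and let i : HeytingHom G₃ G₄ be a Heyting algebra homomorphism with i x = b. Then there is no Heyting algebra homomorphism j : HeytingHom G₄ G₃ such that j ∘ i is the identity homomorphism of G₃. -/
/-- In a totally ordered Heyting algebra, `a ⇨ c = c` whenever `a ≰ c`. -/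
lemma himp_eq_right_of_not_le_of_total {α : Type*} [HeytingAlgebra α]
    (hlin : ∀ a b : α, a ≤ b ∨ b ≤ a) {a c : α} (h : ¬ a ≤ c) : a ⇨ c = c := by
  refine le_antisymm ?_ le_himp
  have hle : (a ⇨ c) ⊓ a ≤ c := himp_inf_le
  rcases hlin (a ⇨ c) a with h' | h'
  · rwa [inf_eq_left.mpr h'] at hle
  · rw [inf_eq_right.mpr h'] at hle
    exact absurd hle h


/-- The three-element Gödel (Heyting) chain is not strongly projective among Heyting
algebras: the embedding of the 3-element chain into the 4-element chain sending the middle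
element to the coatom admits no retraction by a Heyting algebra homomorphism. -/
theorem godel_three_chain_not_strongly_projective
    (G₃ G₄ : Type*) [HeytingAlgebra G₃] [HeytingAlgebra G₄]
    (h₃lin : ∀ a b : G₃, a ≤ b ∨ b ≤ a) (h₄lin : ∀ a b : G₄, a ≤ b ∨ b ≤ a)
    (h₃card : Nat.card G₃ = 3) (h₄card : Nat.card G₄ = 4)
    (x : G₃) (hx₁ : ⊥ < x) (hx₂ : x < ⊤)
    (b : G₄) (hb : IsCoatom b)
    (i : HeytingHom G₃ G₄) (hi : i x = b) :
    ¬ ∃ j : HeytingHom G₄ G₃, j.comp i = HeytingHom.id G₃ := by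
  rintro ⟨j, hj⟩
  have hjb : j b = x := by
    rw [← hi]
    exact DFunLike.congr_fun hj x
  obtain ⟨a, ha⟩ : ∃ a : G₄, a ∉ ({⊥, b, ⊤} : Set G₄) := by
    by_contra! h
    have huniv : ({⊥, b, ⊤} : Set G₄) = Set.univ := Set.eq_univ_of_forall h
    have hle : ({⊥, b, ⊤} : Set G₄).ncard ≤ 3 := by
      have h₁ := Set.ncard_insert_le (⊥ : G₄) {b, ⊤}
      have h₂ := Set.ncard_insert_le b {(⊤ : G₄)}
      rw [Set.ncard_singleton] at h₂
      omega
    rw [huniv, Set.ncard_univ] at hle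
    omega
  simp only [Set.mem_insert_iff, Set.mem_singleton_iff, not_or] at ha
  obtain ⟨ha_bot, ha_b, ha_top⟩ := ha
  have hba : ¬ b ≤ a := fun h => ha_top (hb.2 a (lt_of_le_of_ne h (Ne.symm ha_b)))
  have hab : a ≤ b := (h₄lin a b).resolve_right hba
  have hja_le : j a ≤ x := hjb ▸ OrderHomClass.mono j hab
  have himp_b : x ⇨ j a = j a := by
    rw [← hjb, ← map_himp, himp_eq_right_of_not_le_of_total h₄lin hba]
  have himp_bot : j a ⇨ ⊥ = ⊥ := by
    rw [← map_bot j, ← map_himp,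
      himp_eq_right_of_not_le_of_total h₄lin (fun h => ha_bot (le_bot_iff.mp h))]
  have hne_x : j a ≠ x := by
    intro h
    rw [h, himp_self] at himp_b
    exact hx₂.ne himp_b.symm
  have hne_bot : j a ≠ ⊥ := by
    intro h
    rw [h, himp_self] at himp_bot
    exact (hx₁.trans hx₂).ne himp_bot.symm
  have hne_top : j a ≠ ⊤ := fun h => (h ▸ hja_le).not_gt hx₂
  have : Finite G₃ := Nat.finite_of_card_ne_zero (by omega)
  have hcard : ({j a, ⊥, x, ⊤} : Set G₃).ncard = 4 :=
    Set.ncard_eq_four.mpr ⟨j a, ⊥, x, ⊤, hne_bot, hne_x, hne_top, hx₁.ne, (hx₁.trans hx₂).ne,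
      hx₂.ne, rfl⟩
  have hle := Set.ncard_le_card ({j a, ⊥, x, ⊤} : Set G₃)
  omega
end
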